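/- arXiv:0811.3733 — 4 statements merged into one kernel-verified Lean document; each statement's English description precedes it below -/
import Mathlib

section
/- Let n ≥ 1 and let σ act on K^n entrywise (an F-linear, σ-semilinear bijection); for a K-subspace V of K^n write V^σ = {v^σ : v ∈ V}. Let V and V' be K-subspaces of K^n of the same finite dimension. Then there exists h ∈ GL(n,F) with h·V = V' (h acting K-linearly on column vectors) if and only if dim_K(V ∩ V^σ) = dim_K(V' ∩ V'^σ). -/
open Matrix

/-- The image `Vᶳ = {vᶳ : v ∈ V}` of a `K`-subspace `V ⊆ Kⁿ` under the entrywise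
(σ-semilinear) action of `σ`; it is again a `K`-subspace. -/
def sigmaSub {F K : Type*} [Field F] [Field K] [Algebra F K] (σ : K ≃ₐ[F] K) {n : ℕ}
    (V : Submodule K (Fin n → K)) : Submodule K (Fin n → K) where
  carrier := {w | ∃ v ∈ V, w = fun i => σ (v i)}
  add_mem' := by
    rintro a b ⟨va, hva, rfl⟩ ⟨vb, hvb, rfl⟩
    exact ⟨va + vb, V.add_mem hva hvb, by ext i; simp⟩
  zero_mem' := ⟨0, V.zero_mem, by ext i; simp⟩
  smul_mem' := by
    rintro c a ⟨va, hva, rfl⟩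
    refine ⟨σ.symm c • va, V.smul_mem _ hva, ?_⟩
    ext i
    simp [smul_eq_mul, _root_.map_mul]

/-- The entrywise inclusion `Fⁿ → Kⁿ`. -/
abbrev entrywiseIncl (F K : Type*) [Field F] [Field K] [Algebra F K] (n : ℕ) :
    (Fin n → F) →ₗ[F] (Fin n → K) :=
  (Algebra.linearMap F K).compLeft (Fin n)

/-- The entrywise action of `σ` on `Kⁿ`, as an `F`-linear map. -/
abbrev entrywiseAct {F K : Type*} [Field F] [Field K] [Algebra F K] (σ : K ≃ₐ[F] K) (n : ℕ) :
    (Fin n → K) →ₗ[F] (Fin n → K) :=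
  σ.toLinearMap.compLeft (Fin n)

section

variable {F K : Type*} [Field F] [Field K] [Algebra F K] {σ : K ≃ₐ[F] K} {n : ℕ}

theorem entrywiseAct_smul (c : K) (v : Fin n → K) :
    entrywiseAct σ n (c • v) = σ c • entrywiseAct σ n v := by
  ext i; simp

theorem entrywiseAct_incl (a : Fin n → F) :
    entrywiseAct σ n (entrywiseIncl F K n a) = entrywiseIncl F K n a := by
  ext i; simp

theorem entrywiseIncl_injective : Function.Injective (entrywiseIncl F K n) := by
  intro a b h
  ext i
  exact (algebraMap F K).injective (by simpa using congrFun h i)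

theorem mem_sigmaSub {V : Submodule K (Fin n → K)} {w : Fin n → K} :
    w ∈ sigmaSub σ V ↔ ∃ v ∈ V, entrywiseAct σ n v = w :=
  ⟨fun ⟨v, hv, h⟩ => ⟨v, hv, h.symm⟩, fun ⟨v, hv, h⟩ => ⟨v, hv, h.symm⟩⟩

theorem entrywiseAct_involutive (hinv : ∀ x, σ (σ x) = x) (v : Fin n → K) :
    entrywiseAct σ n (entrywiseAct σ n v) = v := by
  ext i; simp [hinv]

theorem entrywiseAct_mem_inf_sigmaSub (hinv : ∀ x, σ (σ x) = x) {V : Submodule K (Fin n → K)}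
    {w : Fin n → K} (hw : w ∈ V ⊓ sigmaSub σ V) : entrywiseAct σ n w ∈ V ⊓ sigmaSub σ V := by
  obtain ⟨hw, hw'⟩ := hw
  obtain ⟨v, hv, rfl⟩ := mem_sigmaSub.1 hw'
  refine ⟨?_, mem_sigmaSub.2 ⟨_, hw, rfl⟩⟩
  rwa [entrywiseAct_involutive hinv]

theorem exists_eq_add_smul {θ : K} (hθ : σ θ ≠ θ) (hinv : ∀ x, σ (σ x) = x)
    (hfix : ∀ x, σ x = x → x ∈ Set.range (algebraMap F K)) (v : Fin n → K) :
    ∃ a b : Fin n → F, v = entrywiseIncl F K n a + θ • entrywiseIncl F K n b ∧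
      entrywiseIncl F K n b = (θ - σ θ)⁻¹ • (v - entrywiseAct σ n v) := by
  have hne : θ - σ θ ≠ 0 := sub_ne_zero.2 hθ.symm
  have hb (i) : (θ - σ θ)⁻¹ * (v i - σ (v i)) ∈ Set.range (algebraMap F K) := by
    apply hfix
    simp only [map_mul, map_inv₀, map_sub, hinv]
    field_simp
    ring
  have ha (i) : v i - θ * ((θ - σ θ)⁻¹ * (v i - σ (v i))) ∈ Set.range (algebraMap F K) := by
    apply hfix
    simp only [map_mul, map_inv₀, map_sub, hinv]
    field_simp
    ring
  choose b hb using hb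
  choose a ha using ha
  refine ⟨a, b, ?_, ?_⟩
  · ext i; simp [ha, hb]
  · ext i; simp [hb]

theorem eq_zero_of_incl_add_smul_incl_eq_zero {θ : K} (hθ : σ θ ≠ θ) {a b : Fin n → F}
    (h : entrywiseIncl F K n a + θ • entrywiseIncl F K n b = 0) : a = 0 ∧ b = 0 := by
  have h' := congrArg (entrywiseAct σ n) h
  rw [map_add, entrywiseAct_smul, entrywiseAct_incl, entrywiseAct_incl, map_zero] at h'
  have hb : (σ θ - θ) • entrywiseIncl F K n b = 0 := by
    rw [sub_smul, sub_eq_zero]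
    exact add_left_cancel (h'.trans h.symm)
  have hb' : entrywiseIncl F K n b = 0 :=
    (smul_eq_zero.1 hb).resolve_left (sub_ne_zero.2 hθ)
  rw [hb', smul_zero, add_zero] at h
  exact ⟨entrywiseIncl_injective (by rw [h, map_zero]),
    entrywiseIncl_injective (by rw [hb', map_zero])⟩

theorem linearIndependent_incl {θ : K} (hθ : σ θ ≠ θ) (hinv : ∀ x, σ (σ x) = x)
    (hfix : ∀ x, σ x = x → x ∈ Set.range (algebraMap F K)) {m : ℕ} {e : Fin m → Fin n → F}
    (he : LinearIndependent F e) :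
    LinearIndependent K (fun i => entrywiseIncl F K n (e i)) := by
  rw [Fintype.linearIndependent_iff] at he ⊢
  intro c hc
  obtain ⟨p, q, hpq, -⟩ := exists_eq_add_smul hθ hinv hfix c
  have hz : entrywiseIncl F K n (∑ i, p i • e i) + θ • entrywiseIncl F K n (∑ i, q i • e i) = 0 := by
    rw [← hc, hpq, map_sum, map_sum, Finset.smul_sum, ← Finset.sum_add_distrib]
    refine Finset.sum_congr rfl fun i _ => ?_
    ext j
    simp [Algebra.smul_def]
    ring
  obtain ⟨hp, hq⟩ := eq_zero_of_incl_add_smul_incl_eq_zero hθ hz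
  intro i
  simp [hpq, he p hp i, he q hq i]

/-- Galois descent: a `σ`-stable subspace of `Kⁿ` has a basis of vectors in `Fⁿ`. -/
theorem exists_basis_incl_of_stable {θ : K} (hθ : σ θ ≠ θ) (hinv : ∀ x, σ (σ x) = x)
    (hfix : ∀ x, σ x = x → x ∈ Set.range (algebraMap F K)) {W : Submodule K (Fin n → K)}
    (hW : ∀ w ∈ W, entrywiseAct σ n w ∈ W) :
    ∃ e : Fin (Module.finrank K W) → Fin n → F, LinearIndependent F e ∧
      Submodule.span K (Set.range fun i => entrywiseIncl F K n (e i)) = W := by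
  let WF : Submodule F (Fin n → F) := (W.restrictScalars F).comap (entrywiseIncl F K n)
  let B := Module.finBasis F WF
  let e : Fin (Module.finrank F WF) → Fin n → F := fun i => B i
  have he : LinearIndependent F e :=
    B.linearIndependent.map' WF.subtype WF.ker_subtype
  have hspan : Submodule.span K (Set.range fun i => entrywiseIncl F K n (e i)) = W := by
    apply le_antisymm
    · rw [Submodule.span_le]
      rintro _ ⟨i, rfl⟩
      exact (B i).2
    · have key (a : Fin n → F) (ha : a ∈ WF) : entrywiseIncl F K n a ∈
          Submodule.span K (Set.range fun i => entrywiseIncl F K n (e i)) := by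
        have := congrArg (fun x : WF => entrywiseIncl F K n x) (B.sum_repr ⟨a, ha⟩)
        simp only [Submodule.coe_sum, Submodule.coe_smul, map_sum, map_smul] at this
        rw [← this]
        refine Submodule.sum_mem _ fun i _ => ?_
        rw [← algebraMap_smul K]
        exact Submodule.smul_mem _ _ (Submodule.subset_span ⟨i, rfl⟩)
      intro w hw
      obtain ⟨a, b, hab, hb⟩ := exists_eq_add_smul hθ hinv hfix w
      have hbW : entrywiseIncl F K n b ∈ W := by
        rw [hb]
        exact W.smul_mem _ (W.sub_mem hw (hW w hw))
      have haW : entrywiseIncl F K n a ∈ W := by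
        rw [← sub_eq_iff_eq_add] at hab
        rw [← hab]
        exact W.sub_mem hw (W.smul_mem _ hbW)
      rw [hab]
      exact Submodule.add_mem _ (key a haW) (Submodule.smul_mem _ _ (key b hbW))
  have hcard : Module.finrank K W = Module.finrank F WF := by
    have := finrank_span_eq_card (linearIndependent_incl hθ hinv hfix he)
    rwa [hspan, Fintype.card_fin] at this
  rw [hcard]
  exact ⟨e, he, hspan⟩

/-- The normal form of a subspace `V ⊆ Kⁿ` relative to `Fⁿ`, which only depends on the
dimensions of `V` and `V ⊓ Vᶳ`. -/
theorem exists_normal_form {θ : K} (hθ : σ θ ≠ θ) (hinv : ∀ x, σ (σ x) = x)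
    (hfix : ∀ x, σ x = x → x ∈ Set.range (algebraMap F K)) (V : Submodule K (Fin n → K))
    {r m : ℕ} (hr : Module.finrank K ↥(V ⊓ sigmaSub σ V) = r) (hm : Module.finrank K V = r + m) :
    ∃ (e : Fin r → Fin n → F) (a b : Fin m → Fin n → F),
      LinearIndependent F (Sum.elim e (Sum.elim a b)) ∧
      V = Submodule.span K (Set.range (Sum.elim (fun i => entrywiseIncl F K n (e i))
        fun j => entrywiseIncl F K n (a j) + θ • entrywiseIncl F K n (b j))) := by
  set W := V ⊓ sigmaSub σ V
  have hWstable : ∀ w ∈ W, entrywiseAct σ n w ∈ W :=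
    fun w hw => entrywiseAct_mem_inf_sigmaSub hinv hw
  subst hr
  obtain ⟨e, he, hspan⟩ := exists_basis_incl_of_stable hθ hinv hfix hWstable
  obtain ⟨C, hC⟩ := Submodule.exists_isCompl W
  have hWU : W ⊔ C ⊓ V = V := by
    rw [← sup_inf_assoc_of_le C (inf_le_left : W ≤ V), hC.sup_eq_top, top_inf_eq]
  have hWU' : W ⊓ (C ⊓ V) = ⊥ := by
    rw [← inf_assoc, hC.inf_eq_bot, bot_inf_eq]
  have hUm : Module.finrank K ↥(C ⊓ V) = m := by
    have := Submodule.finrank_sup_add_finrank_inf_eq W (C ⊓ V)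
    rw [hWU, hWU', finrank_bot] at this
    lia
  let B := Module.finBasisOfFinrankEq K ↥(C ⊓ V) hUm
  choose a b hab _ using fun j => exists_eq_add_smul hθ hinv hfix (B j : Fin n → K)
  have hBspan : Submodule.span K (Set.range fun j => (B j : Fin n → K)) = C ⊓ V := by
    have := congrArg (Submodule.map (C ⊓ V).subtype) B.span_eq
    rwa [Submodule.map_span, ← Set.range_comp, Submodule.map_top, Submodule.range_subtype] at this
  refine ⟨e, a, b, ?_, ?_⟩
  · have hne : θ - σ θ ≠ 0 := sub_ne_zero.2 hθ.symm
    rw [Fintype.linearIndependent_iff]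
    intro g hg
    simp only [Fintype.sum_sum_type, Sum.elim_inl, Sum.elim_inr] at hg
    set c := fun i => g (Sum.inl i)
    set x := fun j => g (Sum.inr (Sum.inl j))
    set y := fun j => g (Sum.inr (Sum.inr j))
    -- `z j` has trace `x j`, and `z j * θ` has trace `y j`
    let z : Fin m → K := fun j =>
      (algebraMap F K (y j) - algebraMap F K (x j) * σ θ) / (θ - σ θ)
    have hz1 (j) : z j + σ (z j) = algebraMap F K (x j) := by
      simp only [z, map_div₀, map_sub, map_mul, hinv, AlgEquiv.commutes]
      field_simp
      ring
    have hz2 (j) : z j * θ + σ (z j) * σ θ = algebraMap F K (y j) := by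
      simp only [z, map_div₀, map_sub, map_mul, hinv, AlgEquiv.commutes]
      field_simp
      ring
    let u := ∑ j, z j • B j
    have hsum : entrywiseIncl F K n (∑ i, c i • e i) + (u : Fin n → K)
        + entrywiseAct σ n u = 0 := by
      have hterm (j) : z j • (B j : Fin n → K) + entrywiseAct σ n (z j • (B j : Fin n → K)) =
          entrywiseIncl F K n (x j • a j + y j • b j) := by
        rw [hab j, entrywiseAct_smul, map_add, entrywiseAct_smul, entrywiseAct_incl,
          entrywiseAct_incl, map_add, map_smul, map_smul, ← algebraMap_smul K (x j),
          ← algebraMap_smul K (y j), ← hz1, ← hz2]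
        module
      have hu : (u : Fin n → K) = ∑ j, z j • (B j : Fin n → K) := by simp [u]
      rw [hu, map_sum (entrywiseAct σ n), add_assoc, ← Finset.sum_add_distrib,
        Finset.sum_congr rfl fun j _ => hterm j, ← map_sum, ← map_add, Finset.sum_add_distrib, hg,
        map_zero]
    have hce : entrywiseIncl F K n (∑ i, c i • e i) ∈ W := by
      rw [map_sum]
      refine W.sum_mem fun i _ => ?_
      rw [map_smul, ← algebraMap_smul K]
      refine W.smul_mem _ ?_
      rw [← hspan]
      exact Submodule.subset_span ⟨i, rfl⟩
    have hSu : entrywiseAct σ n u ∈ W := by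
      refine ⟨?_, mem_sigmaSub.2 ⟨u, u.2.2, rfl⟩⟩
      rw [← neg_eq_iff_add_eq_zero] at hsum
      rw [← hsum]
      exact V.neg_mem (V.add_mem hce.1 u.2.2)
    have huW : (u : Fin n → K) ∈ W := by
      rw [← entrywiseAct_involutive hinv (u : Fin n → K)]
      exact hWstable _ hSu
    have hu0 : u = 0 := by
      have : (u : Fin n → K) ∈ W ⊓ (C ⊓ V) := ⟨huW, u.2⟩
      rw [hWU'] at this
      exact Subtype.ext (by simpa using this)
    have hz0 := Fintype.linearIndependent_iff.1 B.linearIndependent z hu0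
    have hx0 (j) : x j = 0 := by
      have := hz1 j
      rw [hz0] at this
      simpa using this.symm
    have hy0 (j) : y j = 0 := by
      have := hz2 j
      rw [hz0] at this
      simpa using this.symm
    have hc0 : ∀ i, c i = 0 := by
      refine Fintype.linearIndependent_iff.1 he c ?_
      have hg' : ∑ i, c i • e i + (∑ j, x j • a j + ∑ j, y j • b j) = 0 := hg
      simpa [hx0, hy0] using hg'
    rintro (i | j | j)
    exacts [hc0 i, hx0 j, hy0 j]
  · rw [Set.Sum.elim_range, Submodule.span_union, hspan]
    simp_rw [← hab]
    rw [hBspan, hWU]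

/-- Any linearly independent family is carried to any other one with the same index type by an
automorphism. -/
theorem LinearIndependent.exists_linearEquiv_apply_eq {M ι : Type*} [AddCommGroup M] [Module F M]
    [Finite ι] [FiniteDimensional F M] {v w : ι → M} (hv : LinearIndependent F v)
    (hw : LinearIndependent F w) : ∃ g : M ≃ₗ[F] M, ∀ i, g (v i) = w i := by
  obtain ⟨g, hg⟩ := Submodule.exists_linearEquiv_restrict_eq
    (hv.linearCombinationEquiv.symm ≪≫ₗ hw.linearCombinationEquiv)
  refine ⟨g, fun i => ?_⟩
  have hvi : (hv.linearCombinationEquiv (Finsupp.single i 1) : M) = v i := by simp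
  have hwi : (hw.linearCombinationEquiv (Finsupp.single i 1) : M) = w i := by simp
  rw [← hvi, ← hwi, ← hg]
  simp

/-- A matrix with entries in `F` commutes with the entrywise action of `σ`. -/
theorem entrywiseAct_mulVec {h : Matrix (Fin n) (Fin n) K}
    (hF : ∀ i j, h i j ∈ (algebraMap F K).range) (v : Fin n → K) :
    entrywiseAct σ n (h *ᵥ v) = h *ᵥ entrywiseAct σ n v := by
  ext i
  simp only [LinearMap.compLeft_apply, Function.comp_apply, Matrix.mulVec, dotProduct,
    AlgEquiv.toLinearMap_apply, map_sum, map_mul]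
  refine Finset.sum_congr rfl fun j _ => ?_
  obtain ⟨f, hf⟩ := hF i j
  rw [← hf, AlgEquiv.commutes]

theorem sigmaSub_map_mulVecLin {h : Matrix (Fin n) (Fin n) K}
    (hF : ∀ i j, h i j ∈ (algebraMap F K).range) (V : Submodule K (Fin n → K)) :
    sigmaSub σ (V.map h.mulVecLin) = (sigmaSub σ V).map h.mulVecLin := by
  ext w
  simp only [mem_sigmaSub, Submodule.mem_map, Matrix.mulVecLin_apply]
  constructor
  · rintro ⟨_, ⟨v, hv, rfl⟩, rfl⟩
    exact ⟨_, ⟨v, hv, rfl⟩, (entrywiseAct_mulVec hF v).symm⟩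
  · rintro ⟨_, ⟨v, hv, rfl⟩, rfl⟩
    exact ⟨_, ⟨v, hv, rfl⟩, entrywiseAct_mulVec hF v⟩

theorem incl_mulVec (g : Matrix (Fin n) (Fin n) F) (a : Fin n → F) :
    g.map (algebraMap F K) *ᵥ entrywiseIncl F K n a = entrywiseIncl F K n (g *ᵥ a) := by
  ext i
  exact (RingHom.map_mulVec (algebraMap F K) g a i).symm

end

/-- Two `K`-subspaces `V, V' ⊆ Kⁿ` of the same finite dimension are in the
same `GL(n,F)`-orbit if and only if `dim_K (V ⊓ Vᶳ) = dim_K (V' ⊓ V'ᶳ)`. -/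
theorem stmt4 {F K : Type*} [Field F] [Field K] [Algebra F K] [IsGalois F K]
    (hdeg : Module.finrank F K = 2) (σ : K ≃ₐ[F] K) (hσ : σ ≠ AlgEquiv.refl)
    (n : ℕ) (hn : 1 ≤ n)
    (V V' : Submodule K (Fin n → K))
    (hdim : Module.finrank K V = Module.finrank K V') :
    (∃ h : Matrix (Fin n) (Fin n) K,
        IsUnit h.det ∧ (∀ i j, h i j ∈ (algebraMap F K).range) ∧
        V.map h.mulVecLin = V') ↔
      Module.finrank K ↥(V ⊓ sigmaSub σ V) = Module.finrank K ↥(V' ⊓ sigmaSub σ V') := by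
  have : FiniteDimensional F K := Module.finite_of_finrank_eq_succ hdeg
  have hgroup (τ : K ≃ₐ[F] K) : τ = 1 ∨ τ = σ := by
    have hcard : Nat.card (K ≃ₐ[F] K) = 2 := by rw [IsGalois.card_aut_eq_finrank, hdeg]
    obtain ⟨x, -, hx⟩ := (Nat.card_eq_two_iff' (1 : K ≃ₐ[F] K)).1 hcard
    by_cases h : τ = 1
    · exact Or.inl h
    · exact Or.inr ((hx τ h).trans (hx σ hσ).symm)
  have hinv (x : K) : σ (σ x) = x := by
    rcases hgroup (σ * σ) with h | h
    · exact DFunLike.congr_fun h x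
    · exact absurd (mul_eq_left.1 h) hσ
  have hfix (x : K) (hx : σ x = x) : x ∈ Set.range (algebraMap F K) := by
    rw [IsGalois.mem_range_algebraMap_iff_fixed]
    intro τ
    rcases hgroup τ with rfl | rfl
    · rfl
    · exact hx
  obtain ⟨θ, hθ⟩ : ∃ θ, σ θ ≠ θ := by
    by_contra! h
    exact hσ (AlgEquiv.ext h)
  constructor
  · rintro ⟨h, hdet, hF, rfl⟩
    have hinj : Function.Injective h.mulVecLin :=
      Matrix.mulVec_injective_of_det_ne_zero hdet.ne_zero
    rw [sigmaSub_map_mulVecLin hF, ← Submodule.map_inf _ hinj]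
    exact (Submodule.equivMapOfInjective _ hinj _).finrank_eq
  · intro hr
    obtain ⟨m, hm⟩ := Nat.exists_eq_add_of_le
      (Submodule.finrank_mono (inf_le_left : V ⊓ sigmaSub σ V ≤ V))
    obtain ⟨e, a, b, hli, hV⟩ := exists_normal_form hθ hinv hfix V rfl hm
    obtain ⟨e', a', b', hli', hV'⟩ :=
      exists_normal_form hθ hinv hfix V' hr.symm (hdim.symm.trans hm)
    obtain ⟨g, hg⟩ := hli.exists_linearEquiv_apply_eq hli'
    let G : Matrix (Fin n) (Fin n) F := LinearMap.toMatrix' g.toLinearMap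
    have hG (v : Fin n → F) : G *ᵥ v = g v := LinearMap.toMatrix'_mulVec _ _
    refine ⟨G.map (algebraMap F K), ?_, fun i j => ⟨G i j, rfl⟩, ?_⟩
    · have hdet : IsUnit G.det := by
        rw [LinearMap.det_toMatrix']
        exact g.isUnit_det'
      have := hdet.map (algebraMap F K)
      rwa [RingHom.map_det] at this
    · rw [hV, hV', Submodule.map_span, ← Set.range_comp]
      congr 2
      funext i
      rcases i with i | j
      · have he := hg (Sum.inl i)
        simp only [Sum.elim_inl] at he
        simp only [Function.comp_apply, Sum.elim_inl, Matrix.mulVecLin_apply, incl_mulVec, hG, he]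
      · have ha := hg (Sum.inr (Sum.inl j))
        have hb := hg (Sum.inr (Sum.inr j))
        simp only [Sum.elim_inr, Sum.elim_inl] at ha hb
        simp only [Function.comp_apply, Sum.elim_inr, map_add, map_smul, Matrix.mulVecLin_apply,
          incl_mulVec, hG, ha, hb]
end

section
/- Let n₁ ≤ n₂ be positive integers and n = n₁ + n₂, and let σ act on K^n entrywise; for a K-subspace V of K^n write V^σ = {v^σ : v ∈ V}. Then for every k ∈ {0, 1, …, n₁} there exists a K-subspace V of K^n with dim_K V = n₁ and dim_K(V ∩ V^σ) = n₁ − k. -/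
open Matrix

/-- The graph embedding `x ↦ (x, c x)` for a diagonal matrix `c`, padded by zeros. -/
def diagGraph {K : Type*} [Field K] {n₁ : ℕ} (n₂ : ℕ) (c : Fin n₁ → K) :
    (Fin n₁ → K) →ₗ[K] (Fin (n₁ + n₂) → K) where
  toFun x := Fin.append x fun j => if h : j.val < n₁ then c ⟨j, h⟩ * x ⟨j, h⟩ else 0
  map_add' x y := by
    ext i
    refine Fin.addCases (fun i => ?_) (fun j => ?_) i
    · simp
    · by_cases h : j.val < n₁ <;> simp [h, mul_add]
  map_smul' a x := by
    ext i
    refine Fin.addCases (fun i => ?_) (fun j => ?_) i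
    · simp
    · by_cases h : j.val < n₁ <;> simp [h, mul_left_comm]

lemma diagGraph_castAdd {K : Type*} [Field K] {n₁ : ℕ} (n₂ : ℕ) (c x : Fin n₁ → K)
    (i : Fin n₁) : diagGraph n₂ c x (Fin.castAdd n₂ i) = x i := by
  simp [diagGraph]

lemma diagGraph_natAdd {K : Type*} [Field K] {n₁ : ℕ} (n₂ : ℕ) (c x : Fin n₁ → K)
    (j : Fin n₂) : diagGraph n₂ c x (Fin.natAdd n₁ j) =
      if h : j.val < n₁ then c ⟨j, h⟩ * x ⟨j, h⟩ else 0 := by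
  simp [diagGraph]

lemma diagGraph_injective {K : Type*} [Field K] {n₁ : ℕ} (n₂ : ℕ) (c : Fin n₁ → K) :
    Function.Injective (diagGraph n₂ c) := by
  intro x y h
  ext i
  simpa [diagGraph_castAdd] using congrFun h (Fin.castAdd n₂ i)

lemma map_diagGraph {K : Type*} [Field K] {n₁ n₂ : ℕ} (σ : K →+* K) (c x : Fin n₁ → K) :
    (fun i => σ (diagGraph n₂ c x i)) = diagGraph n₂ (fun i => σ (c i)) (fun i => σ (x i)) := by
  ext i
  refine Fin.addCases (fun i => ?_) (fun j => ?_) i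
  · simp [diagGraph_castAdd]
  · by_cases h : j.val < n₁ <;> simp [diagGraph_natAdd, h]

/-- Two diagonal graphs meet where the diagonals agree on the support. -/
lemma diagGraph_eq_iff {K : Type*} [Field K] {n₁ n₂ : ℕ} (h₁₂ : n₁ ≤ n₂)
    (c d x y : Fin n₁ → K) :
    diagGraph n₂ c x = diagGraph n₂ d y ↔ x = y ∧ ∀ i, c i * x i = d i * x i := by
  constructor
  · intro h
    have hxy : x = y := by
      ext i
      simpa [diagGraph_castAdd] using congrFun h (Fin.castAdd n₂ i)
    subst hxy
    refine ⟨rfl, fun i => ?_⟩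
    simpa [diagGraph_natAdd] using congrFun h (Fin.natAdd n₁ (Fin.castLE h₁₂ i))
  · rintro ⟨rfl, h⟩
    ext i
    refine Fin.addCases (fun i => ?_) (fun j => ?_) i
    · simp [diagGraph_castAdd]
    · by_cases hj : j.val < n₁ <;> simp [diagGraph_natAdd, hj, h]

/-- Extension of a vector by `k` leading zeros. -/
def zeroPad {K : Type*} [Field K] (n₁ k : ℕ) :
    (Fin (n₁ - k) → K) →ₗ[K] (Fin n₁ → K) where
  toFun y i := if h : k ≤ i.val then y ⟨i - k, by omega⟩ else 0
  map_add' x y := by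
    ext i
    by_cases h : k ≤ i.val <;> simp [h]
  map_smul' a x := by
    ext i
    by_cases h : k ≤ i.val <;> simp [h]

lemma zeroPad_injective {K : Type*} [Field K] (n₁ k : ℕ) :
    Function.Injective (zeroPad (K := K) n₁ k) := by
  intro x y h
  ext i
  simpa [zeroPad] using congrFun h ⟨i + k, by omega⟩

lemma mem_range_zeroPad {K : Type*} [Field K] {n₁ k : ℕ} (x : Fin n₁ → K) :
    x ∈ LinearMap.range (zeroPad (K := K) n₁ k) ↔ ∀ i, i.val < k → x i = 0 := by
  constructor
  · rintro ⟨y, rfl⟩ i hi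
    simp [zeroPad, hi]
  · intro h
    refine ⟨fun j => x ⟨j + k, by omega⟩, ?_⟩
    ext i
    by_cases hi : k ≤ i.val
    · simp [zeroPad, hi]
    · simp [zeroPad, hi, h i (by omega)]

/-- For `1 ≤ n₁ ≤ n₂`, `n = n₁ + n₂`, and every `0 ≤ k ≤ n₁`, there is a
`K`-subspace `V ⊆ Kⁿ` with `dim_K V = n₁` and `dim_K (V ⊓ Vᶳ) = n₁ - k`. -/
theorem stmt5 {F K : Type*} [Field F] [Field K] [Algebra F K] [IsGalois F K]
    (hdeg : Module.finrank F K = 2) (σ : K ≃ₐ[F] K) (hσ : σ ≠ AlgEquiv.refl)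
    (δ : K) (hδ : σ δ = -δ) (hδ0 : δ ≠ 0)
    (n₁ n₂ : ℕ) (hn₁ : 1 ≤ n₁) (h₁₂ : n₁ ≤ n₂)
    (k : ℕ) (hk : k ≤ n₁) :
    ∃ V : Submodule K (Fin (n₁ + n₂) → K),
      Module.finrank K V = n₁ ∧ Module.finrank K ↥(V ⊓ sigmaSub σ V) = n₁ - k := by
  obtain ⟨a, ha⟩ : ∃ a, σ a ≠ a := by
    by_contra! h
    exact hσ (AlgEquiv.ext h)
  set c : Fin n₁ → K := fun i => if i.val < k then a else 0 with hc
  have hfix : ∀ x : Fin n₁ → K,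
      (∀ i, c i * x i = σ (c i) * x i) ↔ x ∈ LinearMap.range (zeroPad (K := K) n₁ k) := by
    intro x
    rw [mem_range_zeroPad]
    refine forall_congr' fun i => ?_
    by_cases hi : i.val < k
    · simp [hc, hi, ha.symm]
    · simp [hc, hi]
  refine ⟨LinearMap.range (diagGraph n₂ c), ?_, ?_⟩
  · rw [LinearMap.finrank_range_of_inj (diagGraph_injective n₂ c), Module.finrank_fin_fun]
  · have key : LinearMap.range (diagGraph n₂ c) ⊓ sigmaSub σ (LinearMap.range (diagGraph n₂ c)) =
        LinearMap.range (diagGraph n₂ c ∘ₗ zeroPad n₁ k) := by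
      ext w
      constructor
      · rintro ⟨⟨x, rfl⟩, v, ⟨y, rfl⟩, hw⟩
        have hw' := hw.trans (map_diagGraph (σ : K →+* K) c y)
        obtain ⟨z, rfl⟩ := (hfix x).1 ((diagGraph_eq_iff h₁₂ _ _ _ _).1 hw').2
        exact ⟨z, rfl⟩
      · rintro ⟨z, rfl⟩
        refine ⟨⟨_, rfl⟩, _, ⟨fun i => σ.symm (zeroPad n₁ k z i), rfl⟩, ?_⟩
        refine Eq.trans ?_ (map_diagGraph (σ : K →+* K) c _).symm
        refine (diagGraph_eq_iff h₁₂ _ _ _ _).2 ⟨?_, (hfix _).2 ⟨z, rfl⟩⟩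
        ext i
        simp
    rw [key, LinearMap.finrank_range_of_inj, Module.finrank_fin_fun]
    exact (diagGraph_injective n₂ c).comp (zeroPad_injective n₁ k)
end

section
/- Let (τ, E) be a smooth representation of Kˣ on a complex vector space E which admits a finite filtration 0 = E_0 ⊆ E_1 ⊆ ⋯ ⊆ E_r = E by Kˣ-stable subspaces such that for each 1 ≤ i ≤ r there is a group homomorphism (character) c_i : Kˣ → ℂˣ with τ(t)w − c_i(t)w ∈ E_{i−1} for all t ∈ Kˣ and all w ∈ E_i. Then every vector of E lies in a finite-dimensional Kˣ-stable subspace of E. -/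
open scoped Padic

open Polynomial in
/-- A representation of a group acting on each step of a finite filtration by a scalar
acts through integral (algebraic) operators. -/
theorem Representation.isIntegral_of_filtration {k G E : Type*} [Field k] [Group G]
    [AddCommGroup E] [Module k E] (τ : Representation k G E) {r : ℕ}
    (F : Fin (r + 1) → Submodule k E) (hbot : F 0 = ⊥) (htop : F (Fin.last r) = ⊤)
    (g : G) (c : Fin r → k)
    (hc : ∀ i : Fin r, ∀ w ∈ F i.succ, τ g w - c i • w ∈ F i.castSucc) :
    IsIntegral k (τ g) := by
  have key : ∀ j : Fin (r + 1), ∃ P : k[X], P.Monic ∧ ∀ w ∈ F j, aeval (τ g) P w = 0 := by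
    intro j
    induction j using Fin.induction with
    | zero => exact ⟨1, monic_one, by simp [hbot]⟩
    | succ i ih =>
      obtain ⟨P, hP, hPw⟩ := ih
      refine ⟨P * (X - C (c i)), hP.mul (monic_X_sub_C _), fun w hw ↦ ?_⟩
      simpa [Module.algebraMap_end_apply] using hPw _ (hc i w hw)
  obtain ⟨P, hP, hPw⟩ := key (Fin.last r)
  refine ⟨P, hP, LinearMap.ext fun w ↦ ?_⟩
  simpa [aeval_def] using hPw w (by simp [htop])

/-- A finite-dimensional subspace is contained in a finite-dimensional subspace stable under a
given integral operator and under every operator commuting with it that stabilises the original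
subspace. -/
theorem Module.End.exists_finiteDimensional_stable {k E : Type*} [Field k]
    [AddCommGroup E] [Module k E] {T : Module.End k E} (hT : IsIntegral k T)
    (V : Submodule k E) [FiniteDimensional k V] :
    ∃ W : Submodule k E, FiniteDimensional k W ∧ V ≤ W ∧ (∀ x ∈ W, T x ∈ W) ∧
      ∀ S : Module.End k E, Commute S T → (∀ x ∈ V, S x ∈ V) → ∀ x ∈ W, S x ∈ W := by
  set A := Algebra.adjoin k {T}
  set W := Submodule.map₂ LinearMap.id (Subalgebra.toSubmodule A) V
  have hW : W.FG := hT.fg_adjoin_singleton.map₂ _ (Submodule.fg_iff_finiteDimensional V |>.2 ‹_›)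
  have mem : ∀ a ∈ A, ∀ v ∈ V, a v ∈ W := fun a ha v hv ↦
    Submodule.apply_mem_map₂ LinearMap.id ((Subalgebra.mem_toSubmodule _).2 ha) hv
  refine ⟨W, (Submodule.fg_iff_finiteDimensional W).1 hW,
    fun v hv ↦ mem 1 (one_mem A) v hv, fun x hx ↦ ?_, fun S hS hSV x hx ↦ ?_⟩
  · suffices W ≤ W.comap T from this hx
    refine Submodule.map₂_le.2 fun a ha v hv ↦ ?_
    exact mem (T * a) (mul_mem (Algebra.self_mem_adjoin_singleton k T) ha) v hv
  · suffices W ≤ W.comap S from this hx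
    refine Submodule.map₂_le.2 fun a ha v hv ↦ ?_
    have h : Commute S a := Algebra.commute_of_mem_adjoin_singleton_of_commute ha hS
    have h' : S (a v) = a (S v) := LinearMap.congr_fun h.eq v
    simpa [h'] using mem a ha _ (hSV v hv)

/-- The elements of a group stabilising a finite-dimensional subspace form a subgroup. -/
def Representation.stabilizerSubgroup {k G E : Type*} [Field k] [Group G]
    [AddCommGroup E] [Module k E] (τ : Representation k G E) (W : Submodule k E)
    [FiniteDimensional k W] : Subgroup G where
  carrier := {g | ∀ x ∈ W, τ g x ∈ W}
  one_mem' := by simp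
  mul_mem' := fun ha hb x hx ↦ by simpa using ha _ (hb x hx)
  inv_mem' := fun {g} hg x hx ↦ by
    have hinj : Function.Injective ((τ g).restrict hg) := fun a b hab ↦
      Subtype.ext (τ.apply_bijective g |>.1 (congrArg Subtype.val hab))
    obtain ⟨y, hy⟩ := LinearMap.injective_iff_surjective.1 hinj ⟨x, hx⟩
    have hy' : τ g y = x := congrArg Subtype.val hy
    simp [← hy']

/-- The ring of `p`-adic integers has finite quotients. -/
theorem PadicInt.hasFiniteQuotients (p : ℕ) [Fact p.Prime] : Ring.HasFiniteQuotients ℤ_[p] where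
  finiteQuotient {I} hI := by
    obtain ⟨n, rfl⟩ := PadicInt.ideal_eq_span_pow_p hI
    rw [← PadicInt.ker_toZModPow]
    have : NeZero (p ^ n) := ⟨pow_ne_zero _ (Fact.out : p.Prime).ne_zero⟩
    exact Finite.of_injective _ (RingHom.kerLift_injective (PadicInt.toZModPow (p := p) n))

section

variable (p : ℕ) [Fact p.Prime] {K : Type*} [Field K] [Algebra ℚ_[p] K]
  [FiniteDimensional ℚ_[p] K] [Algebra ℤ_[p] K] [IsScalarTower ℤ_[p] ℚ_[p] K]

/-- An element of spectral norm at most one is integral over `ℤ_p`. -/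
theorem Padic.isIntegral_of_spectralNorm_le_one {x : K} (hx : spectralNorm ℚ_[p] K x ≤ 1) :
    IsIntegral ℤ_[p] x := by
  have hmonic := minpoly.monic (Algebra.IsIntegral.isIntegral (R := ℚ_[p]) x)
  have hcoeff := (spectralValue_le_one_iff hmonic).1 hx
  have hlifts : minpoly ℚ_[p] x ∈ Polynomial.lifts (algebraMap ℤ_[p] ℚ_[p]) :=
    (Polynomial.lifts_iff_coeff_lifts _).2 fun n ↦ ⟨⟨_, hcoeff n⟩, rfl⟩
  obtain ⟨q, hq, -, hqm⟩ := Polynomial.lifts_and_natDegree_eq_and_monic hlifts hmonic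
  refine ⟨q, hqm, ?_⟩
  rw [← Polynomial.aeval_def, ← Polynomial.aeval_map_algebraMap ℚ_[p], hq, minpoly.aeval]

/-- The ring of integers of a finite extension of `ℚ_p` is a valuation ring. -/
theorem Padic.valuationRing_integralClosure : ValuationRing (integralClosure ℤ_[p] K) := by
  have : IsFractionRing (integralClosure ℤ_[p] K) K :=
    integralClosure.isFractionRing_of_finite_extension ℚ_[p] K
  refine (ValuationRing.iff_isInteger_or_isInteger _ K).2 fun x ↦ ?_
  by_cases hx0 : x = 0
  · exact .inl ⟨0, by simp [hx0]⟩
  have hmul : spectralNorm ℚ_[p] K x * spectralNorm ℚ_[p] K x⁻¹ = 1 := by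
    rw [← spectralAlgNorm_def, ← spectralAlgNorm_def, ← spectralAlgNorm_mul,
      mul_inv_cancel₀ hx0, spectralAlgNorm_one]
  rcases le_total (spectralNorm ℚ_[p] K x) 1 with h | h
  · exact .inl ⟨⟨x, Padic.isIntegral_of_spectralNorm_le_one p h⟩, rfl⟩
  · refine .inr ⟨⟨x⁻¹, Padic.isIntegral_of_spectralNorm_le_one p ?_⟩, rfl⟩
    nlinarith [spectralNorm_nonneg (K := ℚ_[p]) x⁻¹]

/-- The ring of integers of a finite extension of `ℚ_p` has finite quotients. -/
theorem Padic.hasFiniteQuotients_integralClosure :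
    Ring.HasFiniteQuotients (integralClosure ℤ_[p] K) := by
  have := PadicInt.hasFiniteQuotients p
  have : Module.Finite ℤ_[p] (integralClosure ℤ_[p] K) :=
    IsIntegralClosure.finite ℤ_[p] ℚ_[p] K (integralClosure ℤ_[p] K)
  exact Ring.HasFiniteQuotients.of_module_finite ℤ_[p] (integralClosure ℤ_[p] K)

/-- Every nonzero element of a finite extension of `ℚ_p` is a unit of the ring of integers times
an integral power of a given uniformizer. -/
theorem Padic.exists_eq_unit_mul_zpow {ϖ : integralClosure ℤ_[p] K} (hϖ : Irreducible ϖ)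
    (t : Kˣ) : ∃ (u : (integralClosure ℤ_[p] K)ˣ) (n : ℤ), (t : K) = (u : K) * (ϖ : K) ^ n := by
  have := Padic.valuationRing_integralClosure p (K := K)
  have := Padic.hasFiniteQuotients_integralClosure p (K := K)
  have hfield : ¬ IsField (integralClosure ℤ_[p] K) := fun h ↦ by
    let := h.toField
    exact hϖ.not_isUnit (isUnit_iff_ne_zero.2 hϖ.ne_zero)
  have : IsDiscreteValuationRing (integralClosure ℤ_[p] K) :=
    ((IsDiscreteValuationRing.TFAE _ hfield).out 1 0).1 ‹_›
  have : IsFractionRing (integralClosure ℤ_[p] K) K :=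
    integralClosure.isFractionRing_of_finite_extension ℚ_[p] K
  obtain ⟨a, b, hb, hab⟩ := IsFractionRing.div_surjective (A := integralClosure ℤ_[p] K) (t : K)
  have hb0 : b ≠ 0 := nonZeroDivisors.ne_zero hb
  have ha0 : a ≠ 0 := by
    rintro rfl
    exact t.ne_zero (by simp [← hab])
  obtain ⟨m, u, rfl⟩ := IsDiscreteValuationRing.eq_unit_mul_pow_irreducible ha0 hϖ
  obtain ⟨n, v, rfl⟩ := IsDiscreteValuationRing.eq_unit_mul_pow_irreducible hb0 hϖ
  have hϖ0 : (ϖ : K) ≠ 0 := by simpa using hϖ.ne_zero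
  have hv : ((v : integralClosure ℤ_[p] K) : K) * ((v⁻¹ : (integralClosure ℤ_[p] K)ˣ) : K) = 1 := by
    exact_mod_cast congrArg Subtype.val v.mul_inv
  have hv0 : ((v : integralClosure ℤ_[p] K) : K) ≠ 0 := left_ne_zero_of_mul_eq_one hv
  refine ⟨u * v⁻¹, m - n, ?_⟩
  rw [← hab, zpow_sub₀ hϖ0, zpow_natCast, zpow_natCast]
  have e : ((v⁻¹ : (integralClosure ℤ_[p] K)ˣ) : K) = ((v : integralClosure ℤ_[p] K) : K)⁻¹ :=
    eq_inv_of_mul_eq_one_right hv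
  simp only [Units.val_mul, MulMemClass.coe_mul, e]
  change ((u : integralClosure ℤ_[p] K) : K) * (ϖ : K) ^ m /
    (((v : integralClosure ℤ_[p] K) : K) * (ϖ : K) ^ n) = _
  field_simp

end

/-- Let `K` be a finite extension of `ℚ_p`, with ring of integers
`O_K = integralClosure ℤ_p K` and uniformizer `π_K` (an irreducible element of the discrete
valuation ring `O_K`).  Let `(τ, E)` be a smooth representation of `Kˣ` on a complex vector
space `E` admitting a finite filtration `0 = E_0 ⊆ E_1 ⊆ ⋯ ⊆ E_r = E` by `Kˣ`-stable
subspaces such that `Kˣ` acts on each successive quotient through a character `c_i`.  Then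
every vector of `E` lies in a finite-dimensional `Kˣ`-stable subspace. -/
theorem stmt12 (p : ℕ) [Fact p.Prime] {K : Type*} [Field K]
    [Algebra ℚ_[p] K] [FiniteDimensional ℚ_[p] K]
    [Algebra ℤ_[p] K] [IsScalarTower ℤ_[p] ℚ_[p] K]
    (πK : integralClosure ℤ_[p] K) (hπ : Irreducible πK)
    {E : Type*} [AddCommGroup E] [Module ℂ E]
    (τ : Representation ℂ Kˣ E)
    (hsmooth : ∀ w : E, ∃ N : ℕ, 1 ≤ N ∧ ∀ u : Kˣ,
      (↑u : K) ∈ integralClosure ℤ_[p] K → ((↑u : K)⁻¹ ∈ integralClosure ℤ_[p] K) →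
      (∃ y ∈ integralClosure ℤ_[p] K, (↑u : K) - 1 = (πK : K) ^ N * y) →
      τ u w = w)
    (r : ℕ) (Efil : Fin (r + 1) → Submodule ℂ E)
    (hmono : Monotone Efil) (hbot : Efil 0 = ⊥) (htop : Efil (Fin.last r) = ⊤)
    (hstab : ∀ (i : Fin (r + 1)) (t : Kˣ), ∀ w ∈ Efil i, τ t w ∈ Efil i)
    (c : Fin r → (Kˣ →* ℂˣ))
    (hchar : ∀ (i : Fin r) (t : Kˣ), ∀ w ∈ Efil i.succ,
      τ t w - (c i t : ℂ) • w ∈ Efil i.castSucc) :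
    ∀ w : E, ∃ W : Submodule ℂ E, FiniteDimensional ℂ W ∧ w ∈ W ∧
      ∀ (t : Kˣ), ∀ x ∈ W, τ t x ∈ W := by
  intro w
  have hO := Padic.hasFiniteQuotients_integralClosure p (K := K)
  let f : (integralClosure ℤ_[p] K)ˣ →* Kˣ :=
    Units.map (algebraMap (integralClosure ℤ_[p] K) K).toMonoidHom
  have hf : ∀ u, (f u : K) = (u : integralClosure ℤ_[p] K) := fun _ ↦ rfl
  have hfinite : (Set.range fun u ↦ τ (f u) w).Finite := by
    obtain ⟨N, -, hN⟩ := hsmooth w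
    set I := Ideal.span {πK ^ N}
    have : Finite (integralClosure ℤ_[p] K ⧸ I) :=
      hO.finiteQuotient (by simpa [I] using fun h ↦ absurd h hπ.ne_zero)
    let q : (integralClosure ℤ_[p] K)ˣ → integralClosure ℤ_[p] K ⧸ I :=
      fun u ↦ Ideal.Quotient.mk I u
    have hfac : Function.FactorsThrough (fun u ↦ τ (f u) w) q := by
      intro u v huv
      obtain ⟨y, hy⟩ := Ideal.mem_span_singleton.1 (Ideal.Quotient.eq.1 huv)
      have h1 : τ (f (v⁻¹ * u)) w = w := by
        refine hN _ (v⁻¹ * u).1.2 ?_ ⟨_, ((v⁻¹ : _ˣ) * y : integralClosure ℤ_[p] K).2, ?_⟩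
        · rw [← Units.val_inv_eq_inv_val, ← map_inv]
          exact (v⁻¹ * u)⁻¹.1.2
        · have h : ((v⁻¹ * u : _ˣ) : integralClosure ℤ_[p] K) - 1 = πK ^ N * ((v⁻¹ : _ˣ) * y) := by
            rw [mul_left_comm, ← hy, mul_sub, Units.val_mul, Units.inv_mul]
          exact congrArg Subtype.val h
      have h2 : f u = f v * f (v⁻¹ * u) := by rw [← map_mul, mul_inv_cancel_left]
      change τ (f u) w = τ (f v) w
      rw [h2, map_mul, Module.End.mul_apply, h1]
    refine (Set.finite_range (Function.extend q (fun u ↦ τ (f u) w) 0)).subset ?_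
    rintro _ ⟨u, rfl⟩
    exact ⟨q u, hfac.extend_apply _ _⟩
  set V := Submodule.span ℂ (Set.range fun u ↦ τ (f u) w)
  have : FiniteDimensional ℂ V := FiniteDimensional.span_of_finite ℂ hfinite
  have hV : ∀ u, ∀ x ∈ V, τ (f u) x ∈ V := by
    intro u x hx
    suffices V ≤ V.comap (τ (f u)) from this hx
    refine Submodule.span_le.2 ?_
    rintro _ ⟨v, rfl⟩
    exact Submodule.subset_span ⟨u * v, by simp⟩
  let ϖ : Kˣ := Units.mk0 (πK : K) (by simpa using hπ.ne_zero)
  obtain ⟨W, hWfin, hVW, hWϖ, hWV⟩ := Module.End.exists_finiteDimensional_stable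
    (τ.isIntegral_of_filtration Efil hbot htop ϖ (fun i ↦ (c i ϖ : ℂ)) fun i ↦ hchar i ϖ) V
  refine ⟨W, hWfin, hVW (Submodule.subset_span ⟨1, by simp⟩), fun t ↦ ?_⟩
  obtain ⟨u, n, ht⟩ := Padic.exists_eq_unit_mul_zpow p hπ t
  have ht' : t = f u * ϖ ^ n := by
    ext
    simpa [ϖ, hf] using ht
  have hu : f u ∈ τ.stabilizerSubgroup W :=
    hWV _ (by rw [commute_iff_eq, ← map_mul, ← map_mul, mul_comm]) (hV u)
  have hϖ : ϖ ∈ τ.stabilizerSubgroup W := hWϖ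
  rw [ht']
  exact mul_mem hu (zpow_mem hϖ n)
end

section
/- Let q ≥ 1 and d ≥ 0 be integers, and let A and B be q×q matrices whose entries are complex polynomials of degree at most d; for a complex number z, A(z) and B(z) denote the complex matrices obtained by entrywise evaluation at z. Suppose that A(0) = I_q and that A(k + k') = A(k)·B(k') for all integers k ≥ 0 and k' ≤ 0 with k + k' ≥ 0. Then A = B as matrices of polynomials, and A(z + z') = A(z)·A(z') for all complex numbers z and z'. -/
/-- Two polynomials over a domain of characteristic zero which agree at all sufficiently large
natural numbers are equal. -/
theorem Polynomial.eq_of_eval_natCast_eq {R : Type*} [CommRing R] [IsDomain R] [CharZero R]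
    {p r : Polynomial R} (m : ℕ) (h : ∀ n : ℕ, m ≤ n → p.eval (n : R) = r.eval (n : R)) :
    p = r := by
  refine Polynomial.eq_of_infinite_eval_eq p r (Set.Infinite.mono ?_
    ((Set.Ici_infinite m).image (f := fun n : ℕ => (n : R)) Nat.cast_injective.injOn))
  rintro _ ⟨n, hn, rfl⟩
  exact h n hn


/-- Let `A`, `B` be `q × q` matrices of complex polynomials of degree at
most `d`, with `A(0) = 1` and `A(k + k') = A(k)·B(k')` for all integers `k ≥ 0`, `k' ≤ 0`
with `k + k' ≥ 0` (evaluation taken entrywise).  Then `A = B` as matrices of polynomials,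
and `A(z + z') = A(z)·A(z')` for all complex numbers `z`, `z'`. -/
theorem stmt14 (q d : ℕ) (hq : 1 ≤ q)
    (A B : Matrix (Fin q) (Fin q) (Polynomial ℂ))
    (hA : ∀ i j, (A i j).natDegree ≤ d) (hB : ∀ i j, (B i j).natDegree ≤ d)
    (h0 : A.map (Polynomial.eval (0 : ℂ)) = 1)
    (hmul : ∀ k k' : ℤ, 0 ≤ k → k' ≤ 0 → 0 ≤ k + k' →
      A.map (Polynomial.eval ((k + k' : ℤ) : ℂ)) =
        A.map (Polynomial.eval ((k : ℤ) : ℂ)) * B.map (Polynomial.eval ((k' : ℤ) : ℂ))) :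
    A = B ∧ ∀ z z' : ℂ,
      A.map (Polynomial.eval (z + z')) =
        A.map (Polynomial.eval z) * A.map (Polynomial.eval z') := by
  have entry : ∀ (z z' : ℂ), A.map (Polynomial.eval (z + z')) =
      A.map (Polynomial.eval z) * B.map (Polynomial.eval z') ↔
      ∀ i j, (A i j).eval (z + z') = ∑ l, (A i l).eval z * (B l j).eval z' := by
    intro z z'
    simp only [← Matrix.ext_iff, Matrix.map_apply, Matrix.mul_apply]
  have left_ext : ∀ (m : ℕ) (z : ℂ) (i j : Fin q),
      (A i j).eval (z + -(m : ℂ)) = ∑ l, (A i l).eval z * (B l j).eval (-(m : ℂ)) := by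
    intro m z i j
    have key : (A i j).comp (Polynomial.X + Polynomial.C (-(m : ℂ))) =
        ∑ l, A i l * Polynomial.C ((B l j).eval (-(m : ℂ))) := by
      refine Polynomial.eq_of_eval_natCast_eq m fun n hn => ?_
      have h := hmul n (-m) (by omega) (by omega) (by omega)
      push_cast at h
      simpa [Polynomial.eval_finsetSum] using (entry _ _).1 h i j
    simpa [Polynomial.eval_finsetSum] using congrArg (Polynomial.eval z) key
  have add_eq : ∀ z z' : ℂ, A.map (Polynomial.eval (z + z')) =
      A.map (Polynomial.eval z) * B.map (Polynomial.eval z') := by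
    refine fun z z' => (entry z z').2 fun i j => ?_
    have key : (A i j).comp (Polynomial.C z - Polynomial.X) =
        ∑ l, Polynomial.C ((A i l).eval z) * (B l j).comp (-Polynomial.X) := by
      refine Polynomial.eq_of_eval_natCast_eq 0 fun n _ => ?_
      simpa [Polynomial.eval_finsetSum, sub_eq_add_neg] using left_ext n z i j
    simpa [Polynomial.eval_finsetSum] using congrArg (Polynomial.eval (-z')) key
  have hAB : A = B := by
    ext1 i j
    refine Polynomial.funext fun z => ?_
    have h := add_eq 0 z
    rw [h0, one_mul, zero_add] at h
    exact congrFun (congrFun h i) j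
  refine ⟨hAB, fun z z' => ?_⟩
  rw [add_eq z z', ← hAB]
end
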